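/- For any infinite, non-compact Hausdorff space X and □ ∈ {1, fin}: G_□(K_{𝕂(X)}, Ω_{𝕂(X)}) ≤_II G_□(K_X, Ω_X). -/

import Mathlib

open Set

section Covers

variable (Y : Type*) [TopologicalSpace Y]

/-- The collection `𝒯_Y` of proper nonempty open subsets of `Y`. -/
def ProperNonemptyOpens : Set (Set Y) :=
  {U | IsOpen U ∧ U.Nonempty ∧ U ≠ Set.univ}

/-- A non-trivial open cover: an open cover not containing the whole space. -/
def IsNontrivialOpenCover (𝒰 : Set (Set Y)) : Prop :=
  (∀ U ∈ 𝒰, IsOpen U) ∧ ⋃₀ 𝒰 = Set.univ ∧ Set.univ ∉ 𝒰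

/-- An ω-cover: a non-trivial open cover such that every finite subset of the
space is contained in some member. -/
def IsOmegaCover (𝒰 : Set (Set Y)) : Prop :=
  IsNontrivialOpenCover Y 𝒰 ∧ ∀ F : Set Y, F.Finite → ∃ U ∈ 𝒰, F ⊆ U

/-- A k-cover: a non-trivial open cover such that every compact proper subset of
the space is contained in some member. -/
def IsKCover (𝒰 : Set (Set Y)) : Prop :=
  IsNontrivialOpenCover Y 𝒰 ∧ ∀ K : Set Y, IsCompact K → K ≠ Set.univ → ∃ U ∈ 𝒰, K ⊆ U

/-- An `𝒜`-cover: a non-trivial open cover such that every `A ∈ 𝒜` is contained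
in some member. -/
def IsACover (𝒜 𝒰 : Set (Set Y)) : Prop :=
  IsNontrivialOpenCover Y 𝒰 ∧ ∀ A ∈ 𝒜, ∃ U ∈ 𝒰, A ⊆ U

/-- `O_Y`: the collection of non-trivial open covers of `Y`. -/
def openCovers : Set (Set (Set Y)) := {𝒰 | IsNontrivialOpenCover Y 𝒰}

/-- `Ω_Y`: the collection of ω-covers of `Y`. -/
def omegaCovers : Set (Set (Set Y)) := {𝒰 | IsOmegaCover Y 𝒰}

/-- `K_Y`: the collection of k-covers of `Y`. -/
def kCovers : Set (Set (Set Y)) := {𝒰 | IsKCover Y 𝒰}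

/-- `O(Y,𝒜)`: the collection of `𝒜`-covers of `Y`. -/
def aCovers (𝒜 : Set (Set Y)) : Set (Set (Set Y)) := {𝒰 | IsACover Y 𝒜 𝒰}

/-- Lindelöf: every open cover has a countable subcover. -/
def IsLindelofSp : Prop :=
  ∀ 𝒰 : Set (Set Y), (∀ U ∈ 𝒰, IsOpen U) → ⋃₀ 𝒰 = Set.univ →
    ∃ 𝒱 ⊆ 𝒰, 𝒱.Countable ∧ ⋃₀ 𝒱 = Set.univ

/-- ε-space: every ω-cover has a countable subset which is still an ω-cover. -/
def IsEpsilonSpace : Prop :=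
  ∀ 𝒰 : Set (Set Y), IsOmegaCover Y 𝒰 → ∃ 𝒱 ⊆ 𝒰, 𝒱.Countable ∧ IsOmegaCover Y 𝒱

/-- k-Lindelöf: every k-cover has a countable subset which is still a k-cover. -/
def IsKLindelof : Prop :=
  ∀ 𝒰 : Set (Set Y), IsKCover Y 𝒰 → ∃ 𝒱 ⊆ 𝒰, 𝒱.Countable ∧ IsKCover Y 𝒱

end Covers

section Games

variable {ι κ : Type*}

/-- The selection principle `S_1(A, B)`. -/
def S1 (A B : Set (Set ι)) : Prop :=
  ∀ a : ℕ → Set ι, (∀ n, a n ∈ A) →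
    ∃ x : ℕ → ι, (∀ n, x n ∈ a n) ∧ Set.range x ∈ B

/-- The selection principle `S_fin(A, B)`. -/
def Sfin (A B : Set (Set ι)) : Prop :=
  ∀ a : ℕ → Set ι, (∀ n, a n ∈ A) →
    ∃ F : ℕ → Set ι, (∀ n, F n ⊆ a n ∧ (F n).Finite) ∧ (⋃ n, F n) ∈ B

/-- One has a winning (full-information) strategy in the single-selection game
`G_1(A, B)`: a function from finite sequences of Two's moves into `A` such that
every legal run produces a set of Two's selections which is not in `B`. -/
def OneWin1 (A B : Set (Set ι)) : Prop :=
  ∃ σ : List ι → Set ι, (∀ h, σ h ∈ A) ∧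
    ∀ x : ℕ → ι, (∀ n, x n ∈ σ (List.ofFn fun i : Fin n => x i)) → Set.range x ∉ B

/-- One has a winning predetermined strategy in `G_1(A, B)`. -/
def OnePre1 (A B : Set (Set ι)) : Prop :=
  ∃ σ : ℕ → Set ι, (∀ n, σ n ∈ A) ∧
    ∀ x : ℕ → ι, (∀ n, x n ∈ σ n) → Set.range x ∉ B

/-- One has a winning constant strategy in `G_1(A, B)`. -/
def OneConst1 (A B : Set (Set ι)) : Prop :=
  ∃ A₀ ∈ A, ∀ x : ℕ → ι, (∀ n, x n ∈ A₀) → Set.range x ∉ B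

/-- Two has a winning (full-information) strategy in `G_1(A, B)`. -/
def TwoWin1 (A B : Set (Set ι)) : Prop :=
  ∃ τ : List (Set ι) → ι, ∀ a : ℕ → Set ι, (∀ n, a n ∈ A) →
    (∀ n, τ (List.ofFn fun i : Fin (n + 1) => a i) ∈ a n) ∧
    Set.range (fun n => τ (List.ofFn fun i : Fin (n + 1) => a i)) ∈ B

/-- Two has a winning Markov strategy in `G_1(A, B)`. -/
def TwoMarkov1 (A B : Set (Set ι)) : Prop :=
  ∃ τ : Set ι → ℕ → ι, ∀ a : ℕ → Set ι, (∀ n, a n ∈ A) →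
    (∀ n, τ (a n) n ∈ a n) ∧ Set.range (fun n => τ (a n) n) ∈ B

/-- One has a winning (full-information) strategy in the finite-selection game
`G_fin(A, B)`. -/
def OneWinFin (A B : Set (Set ι)) : Prop :=
  ∃ σ : List (Set ι) → Set ι, (∀ h, σ h ∈ A) ∧
    ∀ F : ℕ → Set ι,
      (∀ n, F n ⊆ σ (List.ofFn fun i : Fin n => F i) ∧ (F n).Finite) →
      (⋃ n, F n) ∉ B

/-- One has a winning predetermined strategy in `G_fin(A, B)`. -/
def OnePreFin (A B : Set (Set ι)) : Prop :=
  ∃ σ : ℕ → Set ι, (∀ n, σ n ∈ A) ∧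
    ∀ F : ℕ → Set ι, (∀ n, F n ⊆ σ n ∧ (F n).Finite) → (⋃ n, F n) ∉ B

/-- One has a winning constant strategy in `G_fin(A, B)`. -/
def OneConstFin (A B : Set (Set ι)) : Prop :=
  ∃ A₀ ∈ A, ∀ F : ℕ → Set ι, (∀ n, F n ⊆ A₀ ∧ (F n).Finite) → (⋃ n, F n) ∉ B

/-- Two has a winning (full-information) strategy in `G_fin(A, B)`. -/
def TwoWinFin (A B : Set (Set ι)) : Prop :=
  ∃ τ : List (Set ι) → Set ι, ∀ a : ℕ → Set ι, (∀ n, a n ∈ A) →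
    (∀ n, τ (List.ofFn fun i : Fin (n + 1) => a i) ⊆ a n ∧
      (τ (List.ofFn fun i : Fin (n + 1) => a i)).Finite) ∧
    (⋃ n, τ (List.ofFn fun i : Fin (n + 1) => a i)) ∈ B

/-- Two has a winning Markov strategy in `G_fin(A, B)`. -/
def TwoMarkovFin (A B : Set (Set ι)) : Prop :=
  ∃ τ : Set ι → ℕ → Set ι, ∀ a : ℕ → Set ι, (∀ n, a n ∈ A) →
    (∀ n, τ (a n) n ⊆ a n ∧ (τ (a n) n).Finite) ∧ (⋃ n, τ (a n) n) ∈ B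

/-- `G_1(A,C) ≤_II G_1(B,D)`. -/
def LeTwo1 (A C : Set (Set ι)) (B D : Set (Set κ)) : Prop :=
  (TwoMarkov1 A C → TwoMarkov1 B D) ∧
  (TwoWin1 A C → TwoWin1 B D) ∧
  (¬ OneWin1 A C → ¬ OneWin1 B D) ∧
  (¬ OnePre1 A C → ¬ OnePre1 B D) ∧
  (¬ OneConst1 A C → ¬ OneConst1 B D)

/-- `G_fin(A,C) ≤_II G_fin(B,D)`. -/
def LeTwoFin (A C : Set (Set ι)) (B D : Set (Set κ)) : Prop :=
  (TwoMarkovFin A C → TwoMarkovFin B D) ∧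
  (TwoWinFin A C → TwoWinFin B D) ∧
  (¬ OneWinFin A C → ¬ OneWinFin B D) ∧
  (¬ OnePreFin A C → ¬ OnePreFin B D) ∧
  (¬ OneConstFin A C → ¬ OneConstFin B D)

/-- `G_1(A,C) ≡ G_1(B,D)`. -/
def Equiv1 (A C : Set (Set ι)) (B D : Set (Set κ)) : Prop :=
  (TwoMarkov1 A C ↔ TwoMarkov1 B D) ∧
  (TwoWin1 A C ↔ TwoWin1 B D) ∧
  (OneWin1 A C ↔ OneWin1 B D) ∧
  (OnePre1 A C ↔ OnePre1 B D) ∧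
  (OneConst1 A C ↔ OneConst1 B D)

/-- `G_fin(A,C) ≡ G_fin(B,D)`. -/
def EquivFin (A C : Set (Set ι)) (B D : Set (Set κ)) : Prop :=
  (TwoMarkovFin A C ↔ TwoMarkovFin B D) ∧
  (TwoWinFin A C ↔ TwoWinFin B D) ∧
  (OneWinFin A C ↔ OneWinFin B D) ∧
  (OnePreFin A C ↔ OnePreFin B D) ∧
  (OneConstFin A C ↔ OneConstFin B D)

end Games

section Hyperspace

variable (X : Type*) [TopologicalSpace X]

/-- `𝕂(X)`: the nonempty compact subsets of `X`. -/
abbrev KHyper := {K : Set X // IsCompact K ∧ K.Nonempty}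

/-- The Vietoris topology on `𝕂(X)`, generated by the sets
`{K : K ⊆ U}` and `{K : K ∩ U ≠ ∅}` for `U` open in `X`. -/
instance (priority := 2000) vietorisTopology : TopologicalSpace (KHyper X) :=
  TopologicalSpace.generateFrom
    ({S | ∃ U : Set X, IsOpen U ∧ S = {K : KHyper X | K.1 ⊆ U}} ∪
     {S | ∃ U : Set X, IsOpen U ∧ S = {K : KHyper X | (K.1 ∩ U).Nonempty}})

/-- `[U] = {K ∈ 𝕂(X) : K ⊆ U}`. -/
def vLower (U : Set X) : Set (KHyper X) := {K | K.1 ⊆ U}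

/-- `P_fin(X)`: the subspace of `𝕂(X)` of nonempty finite subsets of `X`. -/
abbrev PFinH := {K : KHyper X // K.1.Finite}

/-- A family `𝒜` of subsets of `X` viewed as a subspace `𝔸` of `𝕂(X)`. -/
abbrev ASub (𝒜 : Set (Set X)) := {K : KHyper X // K.1 ∈ 𝒜}

end Hyperspace

/-- An ideal of compact proper subsets of a space: closed under finite unions
and under compact subsets. -/
def IsCompactIdealOn {Y : Type*} [TopologicalSpace Y] (ℬ : Set (Set Y)) : Prop :=
  (∀ B ∈ ℬ, IsCompact B ∧ B ≠ Set.univ) ∧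
  (∀ B ∈ ℬ, ∀ C ∈ ℬ, B ∪ C ∈ ℬ) ∧
  (∀ B ∈ ℬ, ∀ C : Set Y, IsCompact C → C ⊆ B → C ∈ ℬ)

/-- `ℬ` witnesses that the ideal `𝒜` of compact subsets of `X` is closed under
`𝒜`-unions: `ℬ` is an ideal of compact subsets of the subspace `𝔸 = 𝒜` of
`𝕂(X)` such that (i) for every `K₀ ∈ 𝒜`, `{K ∈ 𝔸 : K ⊆ K₀} ∈ ℬ`, and
(ii) for every `KK ∈ ℬ`, `⋃ KK ∈ 𝒜`. -/
def WitnessesAUnions {X : Type*} [TopologicalSpace X] (𝒜 : Set (Set X))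
    (ℬ : Set (Set (ASub X 𝒜))) : Prop :=
  IsCompactIdealOn ℬ ∧
  (∀ K₀ ∈ 𝒜, {K : ASub X 𝒜 | K.1.1 ⊆ K₀} ∈ ℬ) ∧
  (∀ KK ∈ ℬ, (⋃ K ∈ KK, (K : ASub X 𝒜).1.1) ∈ 𝒜)

/-- `X^{≤n}`: the disjoint union of `X, X², …, Xⁿ`. -/
abbrev LePow (X : Type*) (n : ℕ) := Σ i : Fin n, (Fin (i.1 + 1) → X)

/-- `X^{<ω}`: the disjoint union of all finite powers `Xⁿ`, `n ≥ 1`. -/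
abbrev FinPows (X : Type*) := Σ n : ℕ, (Fin (n + 1) → X)

/-- `A^{≤n}`: the copy of the disjoint union of `A, A², …, Aⁿ` inside `X^{≤n}`. -/
def lePowSet {X : Type*} (n : ℕ) (A : Set X) : Set (LePow X n) :=
  {p | ∀ j, p.2 j ∈ A}

/-- `A^{<ω}` inside `X^{<ω}`. -/
def finPowsSet {X : Type*} (A : Set X) : Set (FinPows X) :=
  {p | ∀ j, p.2 j ∈ A}

section Transfer

variable {ι κ : Type*} {A C : Set (Set ι)} {B D : Set (Set κ)} {e : κ → ι} {g : ι → κ}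

lemma Function.LeftInverse.mem_of_mem_image (hg : Function.LeftInverse g e) {b : Set κ} {i : ι}
    (hi : i ∈ e '' b) : g i ∈ b ∧ e (g i) = i := by
  obtain ⟨k, hk, rfl⟩ := hi
  rw [hg k]
  exact ⟨hk, rfl⟩

lemma Function.LeftInverse.subset_of_subset_image (hg : Function.LeftInverse g e) {b : Set κ}
    {F : Set ι} (hF : F ⊆ e '' b) : g '' F ⊆ b ∧ e '' (g '' F) = F := by
  refine ⟨?_, ?_⟩
  · rintro _ ⟨i, hi, rfl⟩
    exact (hg.mem_of_mem_image (hF hi)).1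
  · rw [Set.image_image]
    exact (Set.image_congr fun i hi => (hg.mem_of_mem_image (hF hi)).2).trans (Set.image_id' F)

lemma mem_of_range_mem (hC : ∀ d : Set κ, e '' d ∈ C → d ∈ D) {x : ℕ → ι}
    (hx : ∀ n, e (g (x n)) = x n) (h : Set.range x ∈ C) :
    Set.range (fun n => g (x n)) ∈ D := by
  apply hC
  rw [← Set.range_comp]
  convert h using 2
  exact funext hx

lemma mem_of_iUnion_mem (hC : ∀ d : Set κ, e '' d ∈ C → d ∈ D) {F : ℕ → Set ι}
    (hF : ∀ n, e '' (g '' F n) = F n) (h : (⋃ n, F n) ∈ C) :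
    (⋃ n, g '' F n) ∈ D := by
  apply hC
  rw [Set.image_iUnion]
  simpa only [hF] using h

/-- If `e` has a left inverse, maps members of `B` to members of `A`, and reflects membership
in `C` to membership in `D`, then the single-selection games compare. -/
lemma LeTwo1.of_leftInverse (hg : Function.LeftInverse g e)
    (hA : ∀ b ∈ B, e '' b ∈ A) (hC : ∀ d : Set κ, e '' d ∈ C → d ∈ D) :
    LeTwo1 A C B D := by
  refine ⟨?_, ?_, mt ?_, mt ?_, mt ?_⟩
  · rintro ⟨τ, hτ⟩
    refine ⟨fun b n => g (τ (e '' b) n), fun b hb => ?_⟩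
    obtain ⟨h, hc⟩ := hτ (fun n => e '' b n) fun n => hA _ (hb n)
    have h' := fun n => hg.mem_of_mem_image (h n)
    exact ⟨fun n => (h' n).1, mem_of_range_mem hC (fun n => (h' n).2) hc⟩
  · rintro ⟨τ, hτ⟩
    refine ⟨fun l => g (τ (l.map (e '' ·))), fun b hb => ?_⟩
    obtain ⟨h, hc⟩ := hτ (fun n => e '' b n) fun n => hA _ (hb n)
    have h' := fun n => hg.mem_of_mem_image (h n)
    simp only [List.map_ofFn, Function.comp_def]
    exact ⟨fun n => (h' n).1, mem_of_range_mem hC (fun n => (h' n).2) hc⟩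
  · rintro ⟨σ, hσ, hw⟩
    refine ⟨fun l => e '' σ (l.map g), fun l => hA _ (hσ _), fun x hx hc => ?_⟩
    simp only [List.map_ofFn, Function.comp_def] at hx
    have h' := fun n => hg.mem_of_mem_image (hx n)
    exact hw _ (fun n => (h' n).1) (mem_of_range_mem hC (fun n => (h' n).2) hc)
  · rintro ⟨σ, hσ, hw⟩
    refine ⟨fun n => e '' σ n, fun n => hA _ (hσ n), fun x hx hc => ?_⟩
    have h' := fun n => hg.mem_of_mem_image (hx n)
    exact hw _ (fun n => (h' n).1) (mem_of_range_mem hC (fun n => (h' n).2) hc)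
  · rintro ⟨b, hb, hw⟩
    refine ⟨e '' b, hA _ hb, fun x hx hc => ?_⟩
    have h' := fun n => hg.mem_of_mem_image (hx n)
    exact hw _ (fun n => (h' n).1) (mem_of_range_mem hC (fun n => (h' n).2) hc)

/-- If `e` has a left inverse, maps members of `B` to members of `A`, and reflects membership
in `C` to membership in `D`, then the finite-selection games compare. -/
lemma LeTwoFin.of_leftInverse (hg : Function.LeftInverse g e)
    (hA : ∀ b ∈ B, e '' b ∈ A) (hC : ∀ d : Set κ, e '' d ∈ C → d ∈ D) :
    LeTwoFin A C B D := by
  refine ⟨?_, ?_, mt ?_, mt ?_, mt ?_⟩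
  · rintro ⟨τ, hτ⟩
    refine ⟨fun b n => g '' τ (e '' b) n, fun b hb => ?_⟩
    obtain ⟨h, hc⟩ := hτ (fun n => e '' b n) fun n => hA _ (hb n)
    have h' := fun n => hg.subset_of_subset_image (h n).1
    exact ⟨fun n => ⟨(h' n).1, (h n).2.image g⟩, mem_of_iUnion_mem hC (fun n => (h' n).2) hc⟩
  · rintro ⟨τ, hτ⟩
    refine ⟨fun l => g '' τ (l.map (e '' ·)), fun b hb => ?_⟩
    obtain ⟨h, hc⟩ := hτ (fun n => e '' b n) fun n => hA _ (hb n)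
    have h' := fun n => hg.subset_of_subset_image (h n).1
    simp only [List.map_ofFn, Function.comp_def]
    exact ⟨fun n => ⟨(h' n).1, (h n).2.image g⟩, mem_of_iUnion_mem hC (fun n => (h' n).2) hc⟩
  · rintro ⟨σ, hσ, hw⟩
    refine ⟨fun l => e '' σ (l.map (g '' ·)), fun l => hA _ (hσ _), fun F hF hc => ?_⟩
    simp only [List.map_ofFn, Function.comp_def] at hF
    have h' := fun n => hg.subset_of_subset_image (hF n).1
    exact hw _ (fun n => ⟨(h' n).1, (hF n).2.image g⟩)
      (mem_of_iUnion_mem hC (fun n => (h' n).2) hc)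
  · rintro ⟨σ, hσ, hw⟩
    refine ⟨fun n => e '' σ n, fun n => hA _ (hσ n), fun F hF hc => ?_⟩
    have h' := fun n => hg.subset_of_subset_image (hF n).1
    exact hw _ (fun n => ⟨(h' n).1, (hF n).2.image g⟩)
      (mem_of_iUnion_mem hC (fun n => (h' n).2) hc)
  · rintro ⟨b, hb, hw⟩
    refine ⟨e '' b, hA _ hb, fun F hF hc => ?_⟩
    have h' := fun n => hg.subset_of_subset_image (hF n).1
    exact hw _ (fun n => ⟨(h' n).1, (hF n).2.image g⟩)
      (mem_of_iUnion_mem hC (fun n => (h' n).2) hc)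

end Transfer

section Vietoris

variable {X : Type*} [TopologicalSpace X]

/-- The embedding of `X` into `𝕂(X)` by singletons. -/
def singletonK (x : X) : KHyper X := ⟨{x}, isCompact_singleton, Set.singleton_nonempty x⟩

lemma singletonK_mem_vLower {x : X} {U : Set X} : singletonK x ∈ vLower X U ↔ x ∈ U :=
  Set.singleton_subset_iff

lemma leftInverse_preimage_singletonK :
    Function.LeftInverse (fun V : Set (KHyper X) => singletonK ⁻¹' V) (vLower X) :=
  fun _ => Set.ext fun _ => singletonK_mem_vLower

lemma continuous_singletonK : Continuous (singletonK : X → KHyper X) := by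
  refine continuous_generateFrom_iff.2 ?_
  rintro _ (⟨U, hU, rfl⟩ | ⟨U, hU, rfl⟩)
  · convert hU using 1
    ext x
    exact Set.singleton_subset_iff
  · convert hU using 1
    ext x
    exact Set.singleton_inter_nonempty

lemma isOpen_vLower {U : Set X} (hU : IsOpen U) : IsOpen (vLower X U) :=
  TopologicalSpace.isOpen_generateFrom_of_mem (Or.inl ⟨U, hU, rfl⟩)

lemma vLower_univ : vLower X Set.univ = Set.univ :=
  Set.eq_univ_of_forall fun K => Set.subset_univ K.1

lemma vLower_eq_univ {U : Set X} : vLower X U = Set.univ ↔ U = Set.univ :=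
  ⟨fun h => leftInverse_preimage_singletonK.injective (h.trans vLower_univ.symm),
    fun h => h ▸ vLower_univ⟩

lemma isCompact_biUnion_KHyper {S : Set (KHyper X)} (hS : IsCompact S) :
    IsCompact (⋃ K ∈ S, K.1) := by
  classical
  refine isCompact_of_finite_subcover fun {ι} W hW hcov => ?_
  have hdir : Directed (· ⊆ ·) fun t : Finset ι => vLower X (⋃ i ∈ t, W i) := fun s t =>
    ⟨s ∪ t,
      fun K hK => hK.trans (Set.biUnion_subset_biUnion_left Finset.subset_union_left),
      fun K hK => hK.trans (Set.biUnion_subset_biUnion_left Finset.subset_union_right)⟩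
  obtain ⟨t, ht⟩ := hS.elim_directed_cover (fun t : Finset ι => vLower X (⋃ i ∈ t, W i))
    (fun t => isOpen_vLower (isOpen_biUnion fun i _ => hW i))
    (fun K hK => by
      obtain ⟨t, ht⟩ := K.2.1.elim_finite_subcover W hW
        ((Set.subset_biUnion_of_mem (u := fun K : KHyper X => K.1) hK).trans hcov)
      exact Set.mem_iUnion.2 ⟨t, ht⟩) hdir
  exact ⟨t, Set.iUnion₂_subset fun K hK => ht hK⟩

lemma IsKCover.image_vLower (hnc : ¬ IsCompact (Set.univ : Set X)) {𝒰 : Set (Set X)}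
    (h : IsKCover X 𝒰) : IsKCover (KHyper X) (vLower X '' 𝒰) := by
  obtain ⟨⟨hopen, -, huniv⟩, hk⟩ := h
  have hk' : ∀ K : Set X, IsCompact K → ∃ U ∈ 𝒰, K ⊆ U := fun K hK =>
    hk K hK fun hK' => hnc (hK' ▸ hK)
  refine ⟨⟨?_, ?_, ?_⟩, fun S hS _ => ?_⟩
  · rintro _ ⟨U, hU, rfl⟩
    exact isOpen_vLower (hopen U hU)
  · refine Set.eq_univ_of_forall fun K => ?_
    obtain ⟨U, hU, hKU⟩ := hk' K.1 K.2.1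
    exact ⟨_, ⟨U, hU, rfl⟩, hKU⟩
  · rintro ⟨U, hU, hU'⟩
    exact huniv (vLower_eq_univ.1 hU' ▸ hU)
  · obtain ⟨U, hU, hSU⟩ := hk' _ (isCompact_biUnion_KHyper hS)
    exact ⟨_, ⟨U, hU, rfl⟩, fun K hK => (Set.subset_biUnion_of_mem
      (u := fun K : KHyper X => K.1) hK).trans hSU⟩

lemma IsOmegaCover.of_image_vLower {𝒱 : Set (Set X)}
    (h : IsOmegaCover (KHyper X) (vLower X '' 𝒱)) : IsOmegaCover X 𝒱 := by
  obtain ⟨⟨hopen, -, huniv⟩, hfin⟩ := h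
  have hfin' : ∀ F : Set X, F.Finite → ∃ U ∈ 𝒱, F ⊆ U := fun F hF => by
    obtain ⟨_, ⟨U, hU, rfl⟩, hFU⟩ := hfin _ (hF.image singletonK)
    exact ⟨U, hU, fun x hx => singletonK_mem_vLower.1 (hFU (Set.mem_image_of_mem _ hx))⟩
  refine ⟨⟨fun U hU => ?_, Set.eq_univ_of_forall fun x => ?_, fun hU => ?_⟩, hfin'⟩
  · rw [← leftInverse_preimage_singletonK U]
    exact (hopen _ (Set.mem_image_of_mem _ hU)).preimage continuous_singletonK
  · obtain ⟨U, hU, hxU⟩ := hfin' {x} (Set.finite_singleton x)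
    exact ⟨U, hU, hxU rfl⟩
  · exact huniv ⟨_, hU, vLower_univ⟩

end Vietoris

/-- For any infinite, non-compact Hausdorff space `X` and `□ ∈ {1, fin}`:
`G_□(K_{𝕂(X)}, Ω_{𝕂(X)}) ≤_II G_□(K_X, Ω_X)`. -/
theorem statement19 {X : Type*} [TopologicalSpace X] [T2Space X] [Infinite X]
    (hnc : ¬ IsCompact (Set.univ : Set X)) :
    LeTwo1 (kCovers (KHyper X)) (omegaCovers (KHyper X))
      (kCovers X) (omegaCovers X) ∧
    LeTwoFin (kCovers (KHyper X)) (omegaCovers (KHyper X))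
      (kCovers X) (omegaCovers X) := by
  exact ⟨
    .of_leftInverse leftInverse_preimage_singletonK (fun _ h => h.image_vLower hnc)
      fun _ => IsOmegaCover.of_image_vLower,
    .of_leftInverse leftInverse_preimage_singletonK (fun _ h => h.image_vLower hnc)
      fun _ => IsOmegaCover.of_image_vLower⟩
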